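/- For all integers 1 ≤ k < l and k ≤ n with n ≥ 2 and every real 1 < δ ≤ 2, setting p = l!/((l−k)!·l^k) and M = ⌈8(k·ln n + 1)/(p·(δ−1)²)⌉, there exist M functions from [n] to [l] such that every S ⊆ [n] with |S| = k has between pM/δ and δpM of them injective on S; in particular there exists a δ-balanced (n,k,l)-splitter of size M. -/

import Mathlib

open Finset

attribute [local instance] Classical.propDecidable

/-- The number of functions in the family `F` (indexed by `ι`) that are injective
on the set `S`. -/
noncomputable def injCount {α β ι : Type*} [Fintype ι] (F : ι → α → β) (S : Finset α) : ℕ :=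
  (Finset.univ.filter fun i => Set.InjOn (F i) ↑S).card

/-- `p = l!/((l−k)!·l^k)`, the probability that a uniformly random function from a fixed
`k`-element set to `[l]` is injective. -/
noncomputable def pSplit (k l : ℕ) : ℝ :=
  (Nat.factorial l : ℝ) / ((Nat.factorial (l - k) : ℝ) * (l : ℝ) ^ k)

/-- `M = ⌈8(k·ln n + 1)/(p·(δ−1)²)⌉`. -/
noncomputable def MSplit (n k l : ℕ) (δ : ℝ) : ℕ :=
  ⌈(8 * ((k : ℝ) * Real.log n + 1)) / (pSplit k l * (δ - 1) ^ 2)⌉₊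

lemma pSplit_pos {k l : ℕ} (hl : 0 < l) : 0 < pSplit k l := by
  unfold pSplit
  positivity

/-- The number of functions `[n] → [l]` that are injective on a fixed `k`-set is `p * l ^ n`. -/
lemma card_filter_injOn {n k l : ℕ} (hkl : k < l) (S : Finset (Fin n)) (hS : S.card = k) :
    ((univ.filter fun f : Fin n → Fin l => Set.InjOn f ↑S).card : ℝ) =
      pSplit k l * (l : ℝ) ^ n := by
  have hkn : k ≤ n := by
    simpa [hS] using S.card_le_univ
  have e : {f : Fin n → Fin l // Set.InjOn f ↑S} ≃
      ({x // x ∈ S} ↪ Fin l) × ({x // x ∉ S} → Fin l) :=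
    ((Equiv.piEquivPiSubtypeProd (fun x => x ∈ S) (fun _ => Fin l)).subtypeEquiv
      (q := fun g => Function.Injective g.1) (fun f => by
        rw [Set.injOn_iff_injective]; rfl)).trans
    ((Equiv.prodSubtypeFstEquivSubtypeProd
      (p := fun g : {x // x ∈ S} → Fin l => Function.Injective g)).trans
      ((Equiv.subtypeInjectiveEquivEmbedding _ _).prodCongr (Equiv.refl _)))
  have hcard : (univ.filter fun f : Fin n → Fin l => Set.InjOn f ↑S).card =
      l.descFactorial k * l ^ (n - k) := by
    rw [← Fintype.card_subtype, Fintype.card_congr e, Fintype.card_prod,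
      Fintype.card_embedding_eq, Fintype.card_fun, Fintype.card_subtype_compl]
    simp [hS]
  have hfac : ((l - k).factorial : ℝ) * (l.descFactorial k : ℝ) = l.factorial := by
    exact_mod_cast Nat.factorial_mul_descFactorial hkl.le
  have hl : (l : ℝ) ≠ 0 := by
    exact_mod_cast (Nat.zero_lt_of_lt hkl).ne'
  have hf : ((l - k).factorial : ℝ) ≠ 0 := by positivity
  rw [hcard, pSplit, ← hfac, ← Nat.add_sub_cancel' hkn, pow_add]
  push_cast
  simp only [Nat.add_sub_cancel_left]
  field_simp

/-- Exponential moment bound for the number of indices at which a uniformly random sequence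
of elements of `Ω` lies in an event of probability `q`. -/
lemma sum_exp_mul_card_le {Ω : Type*} [Fintype Ω] (A : Ω → Prop) (M : ℕ) (q t : ℝ)
    (hA : ((univ.filter A).card : ℝ) = q * Fintype.card Ω) :
    ∑ F : Fin M → Ω, Real.exp (t * ((univ.filter fun i => A (F i)).card : ℝ)) ≤
      (Fintype.card Ω : ℝ) ^ M * Real.exp (q * M * (Real.exp t - 1)) := by
  have hprod (F : Fin M → Ω) : Real.exp (t * ((univ.filter fun i => A (F i)).card : ℝ)) =
      ∏ i, ((1 : ℝ) + (if A (F i) then 1 else 0) * (Real.exp t - 1)) := by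
    have h (i : Fin M) : ((1 : ℝ) + (if A (F i) then 1 else 0) * (Real.exp t - 1)) =
        if A (F i) then Real.exp t else 1 := by
      split_ifs <;> ring
    simp only [h]
    rw [prod_ite, prod_const, prod_const_one, mul_one, ← Real.exp_nat_mul, mul_comm]
  have hsum : ∑ x : Ω, ((1 : ℝ) + (if A x then 1 else 0) * (Real.exp t - 1)) =
      Fintype.card Ω * (q * (Real.exp t - 1) + 1) := by
    rw [sum_add_distrib, ← sum_mul, sum_boole, hA]
    simp
    ring
  have hnonneg : 0 ≤ ∑ x : Ω, ((1 : ℝ) + (if A x then 1 else 0) * (Real.exp t - 1)) := by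
    refine sum_nonneg fun x _ => ?_
    have := Real.exp_pos t
    split_ifs <;> linarith
  calc _ = (∑ x : Ω, ((1 : ℝ) + (if A x then 1 else 0) * (Real.exp t - 1))) ^ M := by
        simp only [hprod]
        exact (Fintype.sum_pow (fun x : Ω => (1 : ℝ) + (if A x then 1 else 0) *
          (Real.exp t - 1)) M).symm
    _ ≤ (Fintype.card Ω * Real.exp (q * (Real.exp t - 1))) ^ M := by
        gcongr
        rw [hsum]
        gcongr
        exact Real.add_one_le_exp _
    _ = _ := by
        rw [mul_pow, ← Real.exp_nat_mul]
        congr 2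
        ring

/-- Chernoff's bound in counting form. -/
lemma card_filter_lt_mul_card_le {Ω : Type*} [Fintype Ω] (A : Ω → Prop) (M : ℕ) (q t c : ℝ)
    (hA : ((univ.filter A).card : ℝ) = q * Fintype.card Ω) :
    ((univ.filter fun F : Fin M → Ω =>
        c < t * ((univ.filter fun i => A (F i)).card : ℝ)).card : ℝ) ≤
      (Fintype.card Ω : ℝ) ^ M * Real.exp (q * M * (Real.exp t - 1) - c) := by
  rw [Real.exp_sub, ← mul_div_assoc, le_div_iff₀ (Real.exp_pos c)]
  refine le_trans ?_ (sum_exp_mul_card_le A M q t hA)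
  rw [← nsmul_eq_mul, ← sum_const]
  refine (sum_le_sum fun F hF => Real.exp_le_exp.2 (mem_filter.1 hF).2.le).trans ?_
  exact sum_le_sum_of_subset_of_nonneg (filter_subset _ _) fun _ _ _ => (Real.exp_pos _).le

lemma exp_neg_le_quadratic {u : ℝ} (hu : 0 ≤ u) : Real.exp (-u) ≤ 1 - u + u ^ 2 / 2 := by
  rw [Real.exp_neg, inv_le_iff_one_le_mul₀ (Real.exp_pos u)]
  have h := Real.quadratic_le_exp_of_nonneg hu
  have h2 : 0 ≤ 1 - u + u ^ 2 / 2 := by nlinarith [sq_nonneg (u - 1)]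
  nlinarith [mul_le_mul_of_nonneg_left h h2, sq_nonneg (u ^ 2)]

lemma upper_exponent_le {δ : ℝ} (hδ1 : 1 < δ) (hδ2 : δ ≤ 2) :
    (Real.exp (Real.log δ) - 1) - Real.log δ * δ ≤ -((δ - 1) ^ 2 / 8) := by
  have h := Real.le_log_one_add_of_nonneg (x := δ - 1) (by linarith)
  rw [show 1 + (δ - 1) = δ by ring, div_le_iff₀ (by linarith)] at h
  rw [Real.exp_log (by linarith)]
  have h3 : 0 ≤ (δ - 1) ^ 2 * (7 - δ) := mul_nonneg (sq_nonneg _) (by linarith)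
  have h4 := mul_le_mul_of_nonneg_right h (by linarith : (0 : ℝ) ≤ δ)
  by_contra! hc
  have h5 := mul_lt_mul_of_pos_right hc (by linarith : (0 : ℝ) < δ + 1)
  nlinarith

lemma lower_exponent_le {δ : ℝ} (hδ1 : 1 < δ) (hδ2 : δ ≤ 2) :
    (Real.exp (-(1 - δ⁻¹)) - 1) + (1 - δ⁻¹) * δ⁻¹ ≤ -((δ - 1) ^ 2 / 8) := by
  have hinv : δ⁻¹ ≤ 1 := inv_le_one_of_one_le₀ hδ1.le
  have hu : (δ - 1) / 2 ≤ 1 - δ⁻¹ := by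
    have : 1 - δ⁻¹ = (δ - 1) / δ := by field_simp
    rw [this]
    exact div_le_div_of_nonneg_left (by linarith) (by linarith) hδ2
  have h := exp_neg_le_quadratic (u := 1 - δ⁻¹) (by linarith)
  have h2 : ((δ - 1) / 2) ^ 2 ≤ (1 - δ⁻¹) ^ 2 := by
    gcongr
  nlinarith

/-- A family of `M` functions fails at a fixed `k`-set for at most a `2 / (e * n ^ k)` fraction
of all families, once `p * M * (δ - 1) ^ 2 ≥ 8 * (k * ln n + 1)`. -/
lemma card_filter_unbalanced_le {n k l M : ℕ} (hkl : k < l) (hn : 2 ≤ n) {δ : ℝ} (hδ1 : 1 < δ)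
    (hδ2 : δ ≤ 2)
    (hM : 8 * ((k : ℝ) * Real.log n + 1) ≤ pSplit k l * M * (δ - 1) ^ 2)
    (S : Finset (Fin n)) (hS : S.card = k) :
    ((univ.filter fun F : Fin M → Fin n → Fin l =>
        ¬ (pSplit k l * (M : ℝ) / δ ≤ (injCount F S : ℝ) ∧
          (injCount F S : ℝ) ≤ δ * (pSplit k l * (M : ℝ)))).card : ℝ) ≤
      ((l : ℝ) ^ n) ^ M * (2 * (Real.exp (-1) / (n : ℝ) ^ k)) := by
  set μ : ℝ := pSplit k l * M with hμ
  have hμ0 : 0 ≤ μ := mul_nonneg (pSplit_pos (Nat.zero_lt_of_lt hkl)).le (Nat.cast_nonneg M)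
  have hA : ((univ.filter fun f : Fin n → Fin l => Set.InjOn f ↑S).card : ℝ) =
      pSplit k l * Fintype.card (Fin n → Fin l) := by
    rw [card_filter_injOn hkl S hS]
    simp
  have hexp : Real.exp (-((k : ℝ) * Real.log n + 1)) = Real.exp (-1) / (n : ℝ) ^ k := by
    rw [neg_add, add_comm, Real.exp_add, Real.exp_neg ((k : ℝ) * _), Real.exp_nat_mul,
      Real.exp_log (by positivity), div_eq_mul_inv]
  have htail (t c : ℝ) (h : (Real.exp t - 1) - c ≤ -((δ - 1) ^ 2 / 8)) :
      ((univ.filter fun F : Fin M → Fin n → Fin l =>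
        μ * c < t * (injCount F S : ℝ)).card : ℝ) ≤
      ((l : ℝ) ^ n) ^ M * (Real.exp (-1) / (n : ℝ) ^ k) := by
    have hbound := card_filter_lt_mul_card_le (fun f : Fin n → Fin l => Set.InjOn f ↑S) M
      (pSplit k l) t (μ * c) (by convert hA)
    have hcardFun : (Fintype.card (Fin n → Fin l) : ℝ) = (l : ℝ) ^ n := by simp
    rw [hcardFun, ← hμ] at hbound
    refine Eq.trans_le ?_ (hbound.trans ?_)
    · congr 2
      ext F
      exact mem_filter.trans (Iff.trans (by unfold injCount; congr!) mem_filter.symm)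
    rw [← hexp]
    refine mul_le_mul_of_nonneg_left (Real.exp_le_exp.2 ?_) (by positivity)
    nlinarith [mul_le_mul_of_nonneg_left h hμ0]
  have hup := htail (Real.log δ) (Real.log δ * δ) (upper_exponent_le hδ1 hδ2)
  have hlow := htail (-(1 - δ⁻¹)) (-((1 - δ⁻¹) * δ⁻¹))
    (by simpa using lower_exponent_le hδ1 hδ2)
  have hlog : 0 < Real.log δ := Real.log_pos hδ1
  have hu : 0 < 1 - δ⁻¹ := sub_pos.2 (inv_lt_one_of_one_lt₀ hδ1)
  rw [two_mul, mul_add]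
  refine le_trans ?_ (add_le_add hlow hup)
  norm_cast
  refine (card_le_card fun F hF => ?_).trans (card_union_le _ _)
  simp only [mem_filter, mem_univ, true_and, mem_union] at hF ⊢
  by_contra! h
  refine hF ⟨?_, ?_⟩
  · rw [div_eq_mul_inv]
    refine le_of_mul_le_mul_left ?_ hu
    linarith [h.1]
  · refine le_of_mul_le_mul_left ?_ hlog
    linarith [h.2]

/-- for `1 ≤ k < l`, `k ≤ n`, `n ≥ 2` and `1 < δ ≤ 2`, with
`p = l!/((l−k)!·l^k)` and `M = ⌈8(k ln n + 1)/(p(δ−1)²)⌉`, there exist `M` functions from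
`[n]` to `[l]` such that every `k`-set `S ⊆ [n]` has between `pM/δ` and `δpM` of them
injective on `S`; in particular (since `k < l`, `split(S)` counts injective functions) this
is a `δ`-balanced `(n,k,l)`-splitter of size `M`. -/
theorem stmt3 (n k l : ℕ) (hk : 1 ≤ k) (hkl : k < l) (hkn : k ≤ n) (hn : 2 ≤ n)
    (δ : ℝ) (hδ1 : 1 < δ) (hδ2 : δ ≤ 2) :
    ∃ F : Fin (MSplit n k l δ) → Fin n → Fin l,
      ∀ S : Finset (Fin n), S.card = k →
        pSplit k l * (MSplit n k l δ : ℝ) / δ ≤ (injCount F S : ℝ) ∧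
        (injCount F S : ℝ) ≤ δ * (pSplit k l * (MSplit n k l δ : ℝ)) := by
  have hp : 0 < pSplit k l := pSplit_pos (Nat.zero_lt_of_lt hkl)
  have hM : 8 * ((k : ℝ) * Real.log n + 1) ≤
      pSplit k l * (MSplit n k l δ : ℝ) * (δ - 1) ^ 2 := by
    have hpos : 0 < pSplit k l * (δ - 1) ^ 2 := mul_pos hp (pow_pos (by linarith) 2)
    have h := (div_le_iff₀ hpos).1
      (Nat.le_ceil ((8 * ((k : ℝ) * Real.log n + 1)) / (pSplit k l * (δ - 1) ^ 2)))
    rw [← MSplit] at h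
    linarith
  generalize MSplit n k l δ = M at hM ⊢
  by_contra! hbad
  have hcover : (univ : Finset (Fin M → Fin n → Fin l)) ⊆
      (powersetCard k (univ : Finset (Fin n))).biUnion fun S => univ.filter fun F =>
        ¬ (pSplit k l * (M : ℝ) / δ ≤ (injCount F S : ℝ) ∧
          (injCount F S : ℝ) ≤ δ * (pSplit k l * (M : ℝ))) := by
    intro F _
    obtain ⟨S, hS, hFS⟩ := hbad F
    simp only [mem_biUnion, mem_powersetCard, mem_filter, mem_univ, true_and, subset_univ]
    exact ⟨S, hS, fun h => (hFS h.1).not_ge h.2⟩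
  have hcard : ((l : ℝ) ^ n) ^ M ≤
      ∑ S ∈ powersetCard k (univ : Finset (Fin n)), ((univ.filter fun F : Fin M → Fin n → Fin l =>
        ¬ (pSplit k l * (M : ℝ) / δ ≤ (injCount F S : ℝ) ∧
          (injCount F S : ℝ) ≤ δ * (pSplit k l * (M : ℝ)))).card : ℝ) := by
    have h := (card_le_card hcover).trans card_biUnion_le
    rw [card_univ, Fintype.card_fun, Fintype.card_fun] at h
    simp only [Fintype.card_fin] at h
    exact_mod_cast h
  have hsum := hcard.trans (sum_le_sum fun S hS =>
    card_filter_unbalanced_le hkl hn hδ1 hδ2 hM S (mem_powersetCard.1 hS).2)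
  rw [sum_const, card_powersetCard, card_univ, Fintype.card_fin, nsmul_eq_mul] at hsum
  have hl : (0 : ℝ) < l := by exact_mod_cast Nat.zero_lt_of_lt hkl
  have hN : (0 : ℝ) < ((l : ℝ) ^ n) ^ M := by positivity
  have hnk : (0 : ℝ) < (n : ℝ) ^ k := by positivity
  have hchoose : (n.choose k : ℝ) / (n : ℝ) ^ k ≤ 1 := by
    rw [div_le_one hnk]
    exact_mod_cast Nat.choose_le_pow n k
  have he : 2 * Real.exp (-1) < 1 := by
    linarith [Real.exp_neg_one_lt_half]
  have : ((l : ℝ) ^ n) ^ M * 1 ≤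
      ((l : ℝ) ^ n) ^ M * (2 * Real.exp (-1) * ((n.choose k : ℝ) / (n : ℝ) ^ k)) := by
    calc _ ≤ _ := (mul_one _).trans_le hsum
      _ = _ := by ring
  have h1 := le_of_mul_le_mul_left this hN
  nlinarith [Real.exp_pos (-1)]
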